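/- For the DRB game on the k-dimensional grid, there exists n0 ∈ ℕ (depending only on k and the granularity γ) such that for all n ≥ n0: for every node u and every strategy s ∈ Σ with s > 0, the strategy r_u = k is the unique best response of u to the uniform profile r_{-u} ≡ s, i.e., π_u(k, r_{-u}≡s) > π_u(s', r_{-u}≡s) for every s' ∈ Σ with s' ≠ k. -/

import Mathlib

open Finset

noncomputable section

namespace DRB

/-- Nodes of the `k`-dimensional grid (torus) with side length `n`. -/
abbrev Node (n k : ℕ) := Fin k → Fin n

/-- Grid (Manhattan) distance on the torus:
`d_M(u,v) = Σ_i min(|u_i - v_i|, n - |u_i - v_i|)`. -/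
def dM (n k : ℕ) (u v : Node n k) : ℕ :=
  ∑ i, min ((u i : ℤ) - (v i : ℤ)).natAbs (n - ((u i : ℤ) - (v i : ℤ)).natAbs)

/-- All nodes different from `u`. -/
def others (n k : ℕ) (u : Node n k) : Finset (Node n k) :=
  Finset.univ.filter (fun v => v ≠ u)

/-- Normalization constant `c(s) = Σ_{v ≠ u} d_M(u,v)^{-s}` for node `u`. -/
def cnorm (n k : ℕ) (u : Node n k) (s : ℝ) : ℝ :=
  ∑ v ∈ others n k u, (dM n k u v : ℝ) ^ (-s)

/-- Long-range link probability `p_u(v, s) = d_M(u,v)^{-s} / c(s)`. -/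
def linkProb (n k : ℕ) (u v : Node n k) (s : ℝ) : ℝ :=
  (dM n k u v : ℝ) ^ (-s) / cnorm n k u s

/-- Link distance `D(s) = Σ_{v ≠ u} p_u(v,s) · d_M(u,v)` of node `u`. -/
def linkDist (n k : ℕ) (u : Node n k) (s : ℝ) : ℝ :=
  ∑ v ∈ others n k u, linkProb n k u v s * (dM n k u v : ℝ)

/-- Reciprocity `P_u(r) = Σ_{v ≠ u} p_u(v, r_u) · p_v(u, r_v)`. -/
def recip (n k : ℕ) (r : Node n k → ℝ) (u : Node n k) : ℝ :=
  ∑ v ∈ others n k u, linkProb n k u v (r u) * linkProb n k v u (r v)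

/-- DRB payoff `π_u(r) = D(r_u) · P_u(r)`. -/
def payoff (n k : ℕ) (r : Node n k → ℝ) (u : Node n k) : ℝ :=
  linkDist n k u (r u) * recip n k r u

/-- Membership in the strategy set `Σ = {0, γ, 2γ, 3γ, ...}`. -/
def InSigma (γ s : ℝ) : Prop := ∃ m : ℕ, s = m * γ

/-- A valid strategy profile (every coordinate lies in `Σ`). -/
def ValidProfile (n k : ℕ) (γ : ℝ) (r : Node n k → ℝ) : Prop :=
  ∀ u, InSigma γ (r u)

/-- Nash equilibrium of the DRB game with strategy set `Σ` of granularity `γ`. -/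
def IsNash (n k : ℕ) (γ : ℝ) (r : Node n k → ℝ) : Prop :=
  ∀ u : Node n k, ∀ s : ℝ, InSigma γ s →
    payoff n k r u ≥ payoff n k (Function.update r u s) u

/-- Strict Nash equilibrium. -/
def IsStrictNash (n k : ℕ) (γ : ℝ) (r : Node n k → ℝ) : Prop :=
  ∀ u : Node n k, ∀ s : ℝ, InSigma γ s → s ≠ r u →
    payoff n k r u > payoff n k (Function.update r u s) u

/-- `t`-strong Nash equilibrium: no coalition of size ≤ `t` has a weakly
improving joint deviation that strictly improves some member. -/
def IsTStrongNash (n k : ℕ) (γ : ℝ) (t : ℕ) (r : Node n k → ℝ) : Prop :=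
  ¬ ∃ (C : Finset (Node n k)) (s : Node n k → ℝ),
      C.Nonempty ∧ C.card ≤ t ∧ (∀ u ∈ C, InSigma γ (s u)) ∧
      (∀ u ∈ C,
        payoff n k (fun v => if v ∈ C then s v else r v) u ≥ payoff n k r u) ∧
      (∃ u ∈ C,
        payoff n k (fun v => if v ∈ C then s v else r v) u > payoff n k r u)

/-- Strong Nash equilibrium: coalitions of any size. -/
def IsStrongNash (n k : ℕ) (γ : ℝ) (r : Node n k → ℝ) : Prop :=
  ¬ ∃ (C : Finset (Node n k)) (s : Node n k → ℝ),
      C.Nonempty ∧ (∀ u ∈ C, InSigma γ (s u)) ∧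
      (∀ u ∈ C,
        payoff n k (fun v => if v ∈ C then s v else r v) u ≥ payoff n k r u) ∧
      (∃ u ∈ C,
        payoff n k (fun v => if v ∈ C then s v else r v) u > payoff n k r u)

/-- `b_u(j)`: the number of nodes at grid distance exactly `j` from `u`. -/
def countAt (n k : ℕ) (u : Node n k) (j : ℕ) : ℕ :=
  (Finset.univ.filter (fun v => v ≠ u ∧ dM n k u v = j)).card

/-- One asynchronous best-response step: a single node switches to a best
response to the current profile, all other strategies unchanged. -/
def BRStep (n k : ℕ) (γ : ℝ) (r r' : Node n k → ℝ) : Prop :=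
  ∃ (u : Node n k) (s : ℝ), InSigma γ s ∧
    (∀ t : ℝ, InSigma γ t →
      payoff n k (Function.update r u s) u ≥ payoff n k (Function.update r u t) u) ∧
    r' = Function.update r u s

/-- One synchronous best-response step: every node simultaneously switches
to a best response to the current profile `r`. -/
def SyncStep (n k : ℕ) (γ : ℝ) (r r' : Node n k → ℝ) : Prop :=
  ∀ u : Node n k, InSigma γ (r' u) ∧
    ∀ t : ℝ, InSigma γ t →
      payoff n k (Function.update r u (r' u)) u ≥
        payoff n k (Function.update r u t) u

end DRB


namespace DRB

/-- One-dimensional torus distance. -/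
def dl (n : ℕ) (a b : Fin n) : ℕ :=
  min ((a : ℤ) - (b : ℤ)).natAbs (n - ((a : ℤ) - (b : ℤ)).natAbs)

lemma dM_eq (n k : ℕ) (u v : Node n k) : dM n k u v = ∑ i, dl n (u i) (v i) := rfl

lemma dl_comm (n : ℕ) (a b : Fin n) : dl n a b = dl n b a := by
  unfold dl; omega

lemma dl_le (n : ℕ) (a b : Fin n) : dl n a b ≤ n := by
  unfold dl; omega

lemma dl_lt (n : ℕ) (a b : Fin n) : dl n a b < n := by
  unfold dl; omega

lemma dl_pos (n : ℕ) (a b : Fin n) (h : a ≠ b) : 1 ≤ dl n a b := by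
  have : (a : ℕ) ≠ (b : ℕ) := fun h' => h (Fin.ext h')
  unfold dl; omega

lemma dl_self (n : ℕ) (a : Fin n) : dl n a a = 0 := by
  unfold dl; omega

lemma dl_add (n : ℕ) (a b c : Fin n) : dl n (a + c) (b + c) = dl n a b := by
  unfold dl
  rw [Fin.val_add_eq_ite, Fin.val_add_eq_ite]
  have := a.isLt
  have := b.isLt
  have := c.isLt
  split_ifs <;> omega

lemma dM_comm (n k : ℕ) (u v : Node n k) : dM n k u v = dM n k v u := by
  simp only [dM_eq]
  exact Finset.sum_congr rfl fun i _ => dl_comm n _ _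

lemma dM_le (n k : ℕ) (u v : Node n k) : dM n k u v ≤ k * n := by
  rw [dM_eq]
  calc _ ≤ ∑ _i : Fin k, n := Finset.sum_le_sum fun i _ => dl_le n _ _
    _ = k * n := by simp

lemma dl_le_dM (n k : ℕ) (u v : Node n k) (i : Fin k) : dl n (u i) (v i) ≤ dM n k u v := by
  rw [dM_eq]
  exact Finset.single_le_sum (f := fun i => dl n (u i) (v i)) (fun _ _ => Nat.zero_le _)
    (Finset.mem_univ i)

lemma dM_pos (n k : ℕ) (u v : Node n k) (h : v ≠ u) : 1 ≤ dM n k u v := by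
  obtain ⟨i, hi⟩ := Function.ne_iff.mp h
  exact (dl_pos n _ _ hi.symm).trans (dl_le_dM n k u v i)

lemma dM_add (n k : ℕ) [NeZero n] (u v w : Node n k) :
    dM n k (u + w) (v + w) = dM n k u v := by
  simp only [dM_eq, Pi.add_apply, dl_add]

lemma cnorm_eq (n k : ℕ) [NeZero n] (u v : Node n k) (s : ℝ) : cnorm n k v s = cnorm n k u s := by
  unfold cnorm
  refine Finset.sum_bij' (fun w _ => w + (u - v)) (fun w _ => w - (u - v)) ?_ ?_ ?_ ?_ ?_
  · intro a ha
    simp only [others, Finset.mem_filter, Finset.mem_univ, true_and] at ha ⊢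
    intro h
    apply ha
    have : a = u - (u - v) := eq_sub_of_add_eq h
    rw [this]; abel
  · intro a ha
    simp only [others, Finset.mem_filter, Finset.mem_univ, true_and] at ha ⊢
    intro h
    apply ha
    rw [sub_eq_iff_eq_add] at h
    rw [h]; abel
  · intro a _; abel
  · intro a _; abel
  · intro a _
    have : u = v + (u - v) := by abel
    conv_rhs => rw [this, add_sub_cancel_left, dM_add]

lemma sum_dl (n : ℕ) (a : Fin n) (f : ℕ → ℝ) (hf : ∀ j, 0 ≤ f j) :
    ∑ x : Fin n, f (dl n a x) ≤ 4 * ∑ j ∈ Finset.range n, f j := by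
  rw [← Finset.sum_fiberwise_of_maps_to (s := Finset.univ) (t := Finset.range n)
    (g := fun x => dl n a x) (fun x _ => Finset.mem_range.mpr (dl_lt n a x)), Finset.mul_sum]
  refine Finset.sum_le_sum fun j _ => ?_
  rw [Finset.sum_congr rfl (g := fun _ => f j)
    (fun x hx => by rw [(Finset.mem_filter.mp hx).2]), Finset.sum_const, nsmul_eq_mul]
  refine mul_le_mul_of_nonneg_right ?_ (hf j)
  have hc : (Finset.univ.filter (fun x : Fin n => dl n a x = j)).card ≤
      (({(a : ℤ) - j, (a : ℤ) + j, (a : ℤ) + j - n, (a : ℤ) - j + n} : Finset ℤ)).card := by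
    refine Finset.card_le_card_of_injOn (fun x => ((x : ℕ) : ℤ)) ?_ ?_
    · intro x hx
      have hx' : dl n a x = j := by simpa using hx
      have := a.isLt
      have := x.isLt
      simp only [Finset.coe_insert, Finset.coe_singleton, Set.mem_insert_iff,
        Set.mem_singleton_iff]
      unfold dl at hx'
      omega
    · intro x _ y _ h
      simp only [Nat.cast_inj] at h
      exact Fin.ext h
  exact_mod_cast hc.trans Finset.card_le_four

lemma sum_inv_le (n : ℕ) : ∑ j ∈ Finset.range n, ((max 1 j : ℕ) : ℝ)⁻¹ ≤ 2 + Real.log n := by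
  rcases n with _ | n
  · simp
  rw [Finset.sum_range_succ']
  have h1 : ∑ j ∈ Finset.range n, ((max 1 (j + 1) : ℕ) : ℝ)⁻¹ = (harmonic n : ℝ) := by
    unfold harmonic
    push_cast
    refine Finset.sum_congr rfl fun j _ => ?_
    rw [max_eq_right]
    have : (0 : ℝ) ≤ j := by positivity
    linarith
  rw [h1]
  have h2 := harmonic_le_one_add_log n
  have h3 : Real.log n ≤ Real.log ((n + 1 : ℕ) : ℝ) := by
    rcases Nat.eq_zero_or_pos n with rfl | hn
    · simp
    · exact Real.log_le_log (by exact_mod_cast hn) (by push_cast; linarith)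
  simp only [zero_le, sup_of_le_left, Nat.cast_one, inv_one]
  linarith

/-- The harmonic bound at the navigable exponent. -/
lemma cnorm_k_le (n k : ℕ) (u : Node n k) :
    cnorm n k u (k : ℝ) ≤ (4 * (2 + Real.log n)) ^ k := by
  calc cnorm n k u (k : ℝ)
      ≤ ∑ v ∈ others n k u, ∏ i, ((max 1 (dl n (u i) (v i)) : ℕ) : ℝ)⁻¹ := by
        refine Finset.sum_le_sum fun v hv => ?_
        have hv' : v ≠ u := by simpa [others] using hv
        have hd := dM_pos n k u v hv'
        have hd0 : (0 : ℝ) < dM n k u v := by exact_mod_cast hd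
        rw [Real.rpow_neg hd0.le, Real.rpow_natCast, ← inv_pow]
        calc ((dM n k u v : ℝ)⁻¹) ^ k = ∏ _i : Fin k, (dM n k u v : ℝ)⁻¹ := by simp
          _ ≤ _ := by
            refine Finset.prod_le_prod (fun _ _ => by positivity) fun i _ => ?_
            refine inv_anti₀ (by positivity) ?_
            exact_mod_cast max_le hd (dl_le_dM n k u v i)
    _ ≤ ∑ v : Node n k, ∏ i, ((max 1 (dl n (u i) (v i)) : ℕ) : ℝ)⁻¹ :=
        Finset.sum_le_sum_of_subset_of_nonneg (Finset.subset_univ _)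
          fun _ _ _ => Finset.prod_nonneg fun _ _ => by positivity
    _ = ∏ i : Fin k, ∑ x : Fin n, ((max 1 (dl n (u i) x) : ℕ) : ℝ)⁻¹ := by
        rw [Finset.prod_univ_sum]
        simp
    _ ≤ ∏ _i : Fin k, (4 * (2 + Real.log n)) := by
        refine Finset.prod_le_prod
          (fun _ _ => Finset.sum_nonneg fun _ _ => by positivity) fun i _ => ?_
        refine (sum_dl n (u i) (fun j => ((max 1 j : ℕ) : ℝ)⁻¹) (fun j => by positivity)).trans ?_
        exact mul_le_mul_of_nonneg_left (sum_inv_le n) (by norm_num)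
    _ = _ := by simp

lemma others_pos {n k : ℕ} {u v : Node n k} (hv : v ∈ others n k u) :
    (1 : ℝ) ≤ dM n k u v := by
  exact_mod_cast dM_pos n k u v (by simpa [others] using hv)

lemma cnorm_anti (n k : ℕ) (u : Node n k) {a b : ℝ} (h : a ≤ b) :
    cnorm n k u b ≤ cnorm n k u a :=
  Finset.sum_le_sum fun _ hv =>
    Real.rpow_le_rpow_of_exponent_le (others_pos hv) (neg_le_neg h)

/-- `A(a) ≤ X^(b-a) A(b)` for `a ≤ b`, where `X = k n`. -/
lemma cnorm_le_mul (n k : ℕ) (u : Node n k) {a b : ℝ} (h : a ≤ b) :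
    cnorm n k u a ≤ ((k * n : ℕ) : ℝ) ^ (b - a) * cnorm n k u b := by
  unfold cnorm
  rw [Finset.mul_sum]
  refine Finset.sum_le_sum fun v hv => ?_
  have h1 := others_pos hv
  have h0 : (0 : ℝ) < dM n k u v := by linarith
  have : (dM n k u v : ℝ) ^ (-a) = (dM n k u v : ℝ) ^ (b - a) * (dM n k u v : ℝ) ^ (-b) := by
    rw [← Real.rpow_add h0]; congr 1; ring
  rw [this]
  refine mul_le_mul_of_nonneg_right ?_ (Real.rpow_nonneg h0.le _)
  exact Real.rpow_le_rpow h0.le (by exact_mod_cast dM_le n k u v) (by linarith)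

lemma one_le_cnorm (n k : ℕ) (hk : 1 ≤ k) (hn : 2 ≤ n) (u : Node n k) (a : ℝ) :
    1 ≤ cnorm n k u a := by
  obtain ⟨k, rfl⟩ : ∃ m, k = m + 1 := ⟨k - 1, by omega⟩
  obtain ⟨y, hy⟩ : ∃ y : Fin n, dl n (u 0) y = 1 := by
    by_cases h : (u 0 : ℕ) + 1 < n
    · refine ⟨⟨(u 0 : ℕ) + 1, h⟩, ?_⟩
      unfold dl
      simp only
      omega
    · refine ⟨⟨(u 0 : ℕ) - 1, by omega⟩, ?_⟩
      have := (u 0).isLt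
      unfold dl
      simp only
      omega
  have hd : dM n (k + 1) u (Function.update u 0 y) = 1 := by
    rw [dM_eq, Fin.sum_univ_succ]
    simp [hy, dl_self]
  have hmem : Function.update u 0 y ∈ others n (k + 1) u := by
    simp only [others, Finset.mem_filter, Finset.mem_univ, true_and]
    intro h
    rw [h, dM_eq] at hd
    simp [dl_self] at hd
  unfold cnorm
  have := Finset.single_le_sum (f := fun v => (dM n (k + 1) u v : ℝ) ^ (-a))
    (fun v hv => Real.rpow_nonneg (Nat.cast_nonneg _) _) hmem
  simpa [hd] using this

/-- Lower bound `A(a) ≥ X^(k-a) / (2 k^k)` for `0 ≤ a`. -/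
lemma cnorm_lower (n k : ℕ) (hk : 1 ≤ k) (hn : 2 ≤ n) (u : Node n k) {a : ℝ} (ha : 0 ≤ a) :
    (2 * (k : ℝ) ^ k)⁻¹ * ((k * n : ℕ) : ℝ) ^ ((k : ℝ) - a) ≤ cnorm n k u a := by
  have hk0 : (0 : ℝ) < k := by exact_mod_cast hk
  have hn0 : (0 : ℝ) < n := by exact_mod_cast (by omega : 0 < n)
  have hX : (0 : ℝ) < ((k * n : ℕ) : ℝ) := by push_cast; positivity
  have hcard : (others n k u).card = n ^ k - 1 := by
    unfold others
    rw [Finset.filter_ne', Finset.card_erase_of_mem (Finset.mem_univ _)]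
    simp
  have h2 : (n : ℝ) ^ k / 2 ≤ ((others n k u).card : ℝ) := by
    rw [hcard]
    have h3 : n ≤ n ^ k := Nat.le_self_pow (by omega) n
    have h4 : 2 ≤ n ^ k := hn.trans h3
    rw [Nat.cast_sub (by omega)]
    have : (2 : ℝ) ≤ (n : ℝ) ^ k := by exact_mod_cast h4
    push_cast
    linarith
  have h5 : ((others n k u).card : ℝ) * ((k * n : ℕ) : ℝ) ^ (-a) ≤ cnorm n k u a := by
    rw [← nsmul_eq_mul]
    refine Finset.card_nsmul_le_sum _ _ _ fun v hv => ?_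
    have h1 := others_pos hv
    exact Real.rpow_le_rpow_of_nonpos (by linarith) (by exact_mod_cast dM_le n k u v)
      (by linarith)
  refine le_trans ?_ h5
  rw [sub_eq_add_neg, Real.rpow_add hX, Real.rpow_natCast, ← mul_assoc]
  refine mul_le_mul_of_nonneg_right ?_ (Real.rpow_nonneg hX.le _)
  refine le_trans (le_of_eq ?_) h2
  push_cast
  rw [mul_pow]
  field_simp

lemma payoff_eq (n k : ℕ) [NeZero n] (u : Node n k) (s r : ℝ) :
    payoff n k (Function.update (fun _ => s) u r) u =
      cnorm n k u (r - 1) * cnorm n k u (r + s) / (cnorm n k u r ^ 2) / cnorm n k u s := by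
  have h1 : linkDist n k u r = cnorm n k u (r - 1) / cnorm n k u r := by
    unfold linkDist linkProb
    conv_rhs => unfold cnorm
    rw [Finset.sum_div]
    refine Finset.sum_congr rfl fun v hv => ?_
    have h0 : (0 : ℝ) < dM n k u v := by linarith [others_pos hv]
    have : (dM n k u v : ℝ) ^ (-(r - 1)) = (dM n k u v : ℝ) ^ (-r) * dM n k u v := by
      rw [← Real.rpow_add_one h0.ne']; congr 1; ring
    rw [this]
    unfold cnorm
    ring
  have h2 : recip n k (Function.update (fun _ => s) u r) u =
      cnorm n k u (r + s) / cnorm n k u r / cnorm n k u s := by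
    unfold recip
    have : cnorm n k u (r + s) = ∑ v ∈ others n k u, (dM n k u v : ℝ) ^ (-(r + s)) := rfl
    rw [this, Finset.sum_div, Finset.sum_div]
    refine Finset.sum_congr rfl fun v hv => ?_
    have hv' : v ≠ u := by simpa [others] using hv
    have h0 : (0 : ℝ) < dM n k u v := by linarith [others_pos hv]
    rw [Function.update_self, Function.update_of_ne hv']
    unfold linkProb
    rw [cnorm_eq n k u v, dM_comm n k v u, neg_add, Real.rpow_add h0]
    ring
  unfold payoff
  rw [Function.update_self, h1, h2]
  ring

lemma eventually_bound (k g : ℕ) (hg : 2 ≤ g) (c : ℝ) (hc : 0 < c) :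
    ∃ n0 : ℕ, ∀ n : ℕ, n0 ≤ n →
      ((4 * (2 + Real.log n)) ^ k) ^ 3 < c * (n : ℝ) ^ ((g : ℝ)⁻¹) := by
  have hg0 : (0 : ℝ) < (g : ℝ)⁻¹ := by
    have : (0 : ℝ) < g := by exact_mod_cast (by omega : 0 < g)
    positivity
  have h := isLittleO_log_rpow_rpow_atTop ((k * 3 : ℕ) : ℝ) hg0
  have hC : (0 : ℝ) < c / 12 ^ (k * 3) / 2 := by positivity
  have h1 := (h.def hC).and (Filter.eventually_ge_atTop (Real.exp 1))
  have h2 := (tendsto_natCast_atTop_atTop (R := ℝ)).eventually h1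
  obtain ⟨n0, hn0⟩ := Filter.eventually_atTop.mp h2
  refine ⟨n0, fun n hn => ?_⟩
  obtain ⟨ha, hb⟩ := hn0 n hn
  have hnpos : (0 : ℝ) < n := lt_of_lt_of_le (Real.exp_pos 1) hb
  have hlog : 1 ≤ Real.log n := by
    rw [Real.le_log_iff_exp_le hnpos]; exact hb
  have hp : (0 : ℝ) < (n : ℝ) ^ ((g : ℝ)⁻¹) := Real.rpow_pos_of_pos hnpos _
  rw [Real.rpow_natCast, Real.norm_of_nonneg (by positivity), Real.norm_of_nonneg hp.le] at ha
  rw [← pow_mul]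
  calc (4 * (2 + Real.log n)) ^ (k * 3) ≤ (12 * Real.log n) ^ (k * 3) := by
        refine pow_le_pow_left₀ (by linarith) (by linarith) _
    _ = 12 ^ (k * 3) * Real.log n ^ (k * 3) := mul_pow _ _ _
    _ ≤ 12 ^ (k * 3) * (c / 12 ^ (k * 3) / 2 * (n : ℝ) ^ ((g : ℝ)⁻¹)) :=
        mul_le_mul_of_nonneg_left ha (by positivity)
    _ = c * (n : ℝ) ^ ((g : ℝ)⁻¹) / 2 := by field_simp
    _ < c * (n : ℝ) ^ ((g : ℝ)⁻¹) := half_lt_self (by positivity)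

lemma upper_bound (n k : ℕ) (hk : 1 ≤ k) (hn : 2 ≤ n) (u : Node n k) (γ s r : ℝ)
    (hγ0 : 0 < γ) (hγ1 : γ ≤ 1) (hs : γ ≤ s) (hr0 : 0 ≤ r)
    (hr : r + γ ≤ k ∨ k + γ ≤ r) :
    cnorm n k u (r - 1) * cnorm n k u (r + s) / (cnorm n k u r ^ 2) ≤
      ((k * n : ℕ) : ℝ) ^ (1 - γ) * cnorm n k u k / (2 * (k : ℝ) ^ k)⁻¹ := by
  have hk0 : (0 : ℝ) < k := by exact_mod_cast hk
  have hn0 : (0 : ℝ) < n := by exact_mod_cast (by omega : 0 < n)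
  have hX : (0 : ℝ) < ((k * n : ℕ) : ℝ) := by push_cast; positivity
  have A1 : ∀ a, 1 ≤ cnorm n k u a := one_le_cnorm n k hk hn u
  have A0 : ∀ a, 0 < cnorm n k u a := fun a => lt_of_lt_of_le one_pos (A1 a)
  set X : ℝ := ((k * n : ℕ) : ℝ) with hXdef
  have hc0 : 0 < (2 * (k : ℝ) ^ k)⁻¹ := by positivity
  have hc1 : (2 * (k : ℝ) ^ k)⁻¹ ≤ 1 := by
    apply inv_le_one_of_one_le₀
    have : (1 : ℝ) ≤ (k : ℝ) ^ k := one_le_pow₀ (by exact_mod_cast hk)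
    linarith
  have hlow := cnorm_lower n k hk hn u hr0
  set c := (2 * (k : ℝ) ^ k)⁻¹
  rcases hr with hr | hr
  · have e1 : cnorm n k u (r - 1) ≤ X * cnorm n k u r := by
      have := cnorm_le_mul n k u (a := r - 1) (b := r) (by linarith)
      rwa [sub_sub_cancel, Real.rpow_one] at this
    have e2 : cnorm n k u (r + s) ≤ X ^ ((k : ℝ) - (r + γ)) * cnorm n k u k :=
      (cnorm_anti n k u (by linarith)).trans (cnorm_le_mul n k u hr)
    have e3 : cnorm n k u (r + s) ≤ X ^ (-γ) * cnorm n k u k / c * cnorm n k u r := by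
      refine e2.trans ?_
      have : X ^ ((k : ℝ) - (r + γ)) = X ^ (-γ) / c * (c * X ^ ((k : ℝ) - r)) := by
        rw [← mul_assoc, div_mul_cancel₀ _ hc0.ne', ← Real.rpow_add hX]
        congr 1; ring
      rw [this]
      have hp : 0 ≤ X ^ (-γ) / c := div_nonneg (Real.rpow_nonneg hX.le _) hc0.le
      calc X ^ (-γ) / c * (c * X ^ ((k : ℝ) - r)) * cnorm n k u k
          ≤ X ^ (-γ) / c * cnorm n k u r * cnorm n k u k :=
            mul_le_mul_of_nonneg_right (mul_le_mul_of_nonneg_left hlow hp) (A0 _).le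
        _ = _ := by ring
    rw [div_le_iff₀ (pow_pos (A0 r) 2)]
    calc cnorm n k u (r - 1) * cnorm n k u (r + s)
        ≤ (X * cnorm n k u r) * (X ^ (-γ) * cnorm n k u k / c * cnorm n k u r) :=
          mul_le_mul e1 e3 (A0 _).le (mul_nonneg hX.le (A0 _).le)
      _ = (X ^ (1 : ℝ) * X ^ (-γ)) * cnorm n k u k / c * cnorm n k u r ^ 2 := by
          rw [Real.rpow_one]; ring
      _ = _ := by rw [← Real.rpow_add hX, ← sub_eq_add_neg]
  · have e1 : cnorm n k u (r - 1) ≤ X ^ (1 - γ) * cnorm n k u k := by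
      refine (cnorm_anti n k u (a := k + γ - 1) (by linarith)).trans ?_
      have := cnorm_le_mul n k u (a := k + γ - 1) (b := k) (by linarith)
      rwa [show (k : ℝ) - (k + γ - 1) = 1 - γ by ring] at this
    have e2 : cnorm n k u (r + s) ≤ cnorm n k u r := cnorm_anti n k u (by linarith)
    have hY : 0 ≤ X ^ (1 - γ) * cnorm n k u k := mul_nonneg (Real.rpow_nonneg hX.le _) (A0 _).le
    refine le_trans ?_ (le_div_self hY hc0 hc1)
    rw [div_le_iff₀ (pow_pos (A0 r) 2)]
    refine mul_le_mul e1 (e2.trans ?_) (A0 _).le hY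
    exact le_self_pow₀ (A1 r) (by norm_num)

lemma lower_bound (n k : ℕ) (hk : 1 ≤ k) (hn : 2 ≤ n) (u : Node n k) (s : ℝ) :
    (2 * (k : ℝ) ^ k)⁻¹ * ((k * n : ℕ) : ℝ) / cnorm n k u k ^ 2 ≤
      cnorm n k u (k - 1) * cnorm n k u (k + s) / (cnorm n k u k ^ 2) := by
  have A1 : ∀ a, 1 ≤ cnorm n k u a := one_le_cnorm n k hk hn u
  have hk1 : (1 : ℝ) ≤ k := by exact_mod_cast hk
  have h := cnorm_lower n k hk hn u (a := k - 1) (by linarith)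
  rw [sub_sub_cancel, Real.rpow_one] at h
  refine div_le_div_of_nonneg_right (h.trans ?_) (sq_nonneg _)
  exact le_mul_of_one_le_right (by linarith [A1 (k - 1)]) (A1 _)

end DRB

/-- For the DRB game on the `k`-dimensional grid there exists `n0`
(depending only on `k` and `γ = 1/g`) such that for all `n ≥ n0`, for every node
`u` and every `s ∈ Σ` with `s > 0`, the strategy `k` is the unique best response
of `u` to the uniform profile `r_{-u} ≡ s`. -/
theorem navigable_unique_best_response_to_uniform (k g : ℕ) (hk : 1 ≤ k) (hg : 2 ≤ g) :
    ∃ n0 : ℕ, ∀ n : ℕ, n0 ≤ n →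
      ∀ u : DRB.Node n k, ∀ s : ℝ, DRB.InSigma (g : ℝ)⁻¹ s → 0 < s →
        ∀ s' : ℝ, DRB.InSigma (g : ℝ)⁻¹ s' → s' ≠ (k : ℝ) →
          DRB.payoff n k (Function.update (fun _ => s) u (k : ℝ)) u >
            DRB.payoff n k (Function.update (fun _ => s) u s') u := by
  have hk0 : (0 : ℝ) < k := by exact_mod_cast hk
  have hg0 : (0 : ℝ) < g := by exact_mod_cast (by omega : 0 < g)
  have hc0 : 0 < (2 * (k : ℝ) ^ k)⁻¹ := by positivity
  obtain ⟨n0, hn0⟩ := DRB.eventually_bound k g hg (((2 * (k : ℝ) ^ k)⁻¹) ^ 2) (by positivity)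
  refine ⟨max n0 2, fun n hn u s hs hspos s' hs' hne => ?_⟩
  have hn2 : 2 ≤ n := le_of_max_le_right hn
  have hB := hn0 n (le_of_max_le_left hn)
  haveI : NeZero n := ⟨by omega⟩
  have hγ0 : 0 < (g : ℝ)⁻¹ := by positivity
  have hγ1 : (g : ℝ)⁻¹ ≤ 1 := inv_le_one_of_one_le₀ (by exact_mod_cast (by omega : 1 ≤ g))
  obtain ⟨m, rfl⟩ := hs
  obtain ⟨m', rfl⟩ := hs'
  have hkg : (k : ℝ) = ((k * g : ℕ) : ℝ) * (g : ℝ)⁻¹ := by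
    push_cast; field_simp
  have hm : 1 ≤ m := by
    rcases Nat.eq_zero_or_pos m with rfl | h
    · simp at hspos
    · exact h
  have hs : (g : ℝ)⁻¹ ≤ m * (g : ℝ)⁻¹ :=
    le_mul_of_one_le_left hγ0.le (by exact_mod_cast hm)
  have hr : (m' : ℝ) * (g : ℝ)⁻¹ + (g : ℝ)⁻¹ ≤ k ∨ (k : ℝ) + (g : ℝ)⁻¹ ≤ m' * (g : ℝ)⁻¹ := by
    have hne' : m' ≠ k * g := by
      rintro rfl
      exact hne hkg.symm
    rcases lt_or_gt_of_ne hne' with h | h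
    · left
      rw [hkg, ← add_one_mul]
      exact mul_le_mul_of_nonneg_right (by exact_mod_cast h) hγ0.le
    · right
      rw [hkg, ← add_one_mul]
      exact mul_le_mul_of_nonneg_right (by exact_mod_cast h) hγ0.le
  have hU := DRB.upper_bound n k hk hn2 u _ _ _ hγ0 hγ1 hs (by positivity) hr
  have hL := DRB.lower_bound n k hk hn2 u (m * (g : ℝ)⁻¹)
  have A1 : ∀ a, 1 ≤ DRB.cnorm n k u a := DRB.one_le_cnorm n k hk hn2 u
  have hcs := A1 (m * (g : ℝ)⁻¹)
  rw [DRB.payoff_eq, DRB.payoff_eq, gt_iff_lt]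
  refine div_lt_div_of_pos_right (hU.trans_lt (lt_of_lt_of_le ?_ hL)) (by linarith)
  have hLk := A1 k
  have hA := DRB.cnorm_k_le n k u
  have hn0' : (0 : ℝ) < n := by exact_mod_cast (by omega : 0 < n)
  have hX : (0 : ℝ) < ((k * n : ℕ) : ℝ) := by push_cast; positivity
  have hnX : (n : ℝ) ≤ ((k * n : ℕ) : ℝ) := by
    exact_mod_cast Nat.le_mul_of_pos_left n hk
  have hpow : (n : ℝ) ^ ((g : ℝ)⁻¹) ≤ ((k * n : ℕ) : ℝ) ^ ((g : ℝ)⁻¹) :=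
    Real.rpow_le_rpow hn0'.le hnX hγ0.le
  set X : ℝ := ((k * n : ℕ) : ℝ)
  set L := DRB.cnorm n k u k
  set c := (2 * (k : ℝ) ^ k)⁻¹
  have hL3 : L ^ 3 < c ^ 2 * X ^ ((g : ℝ)⁻¹) := by
    calc L ^ 3 ≤ ((4 * (2 + Real.log n)) ^ k) ^ 3 := pow_le_pow_left₀ (by linarith) hA 3
      _ < c ^ 2 * (n : ℝ) ^ ((g : ℝ)⁻¹) := hB
      _ ≤ _ := mul_le_mul_of_nonneg_left hpow (by positivity)
  have hXX : X ^ (1 - (g : ℝ)⁻¹) * X ^ ((g : ℝ)⁻¹) = X := by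
    rw [← Real.rpow_add hX, sub_add_cancel, Real.rpow_one]
  have hP : 0 < X ^ (1 - (g : ℝ)⁻¹) := Real.rpow_pos_of_pos hX _
  have hL0 : 0 < L := by linarith
  rw [div_lt_div_iff₀ hc0 (by positivity)]
  calc X ^ (1 - (g : ℝ)⁻¹) * L * L ^ 2 = X ^ (1 - (g : ℝ)⁻¹) * L ^ 3 := by ring
    _ < X ^ (1 - (g : ℝ)⁻¹) * (c ^ 2 * X ^ ((g : ℝ)⁻¹)) := mul_lt_mul_of_pos_left hL3 hP
    _ = c * (X ^ (1 - (g : ℝ)⁻¹) * X ^ ((g : ℝ)⁻¹)) * c := by ring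
    _ = c * X * c := by rw [hXX]
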